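/- Let 𝓛 be an algebraic de Branges space, W : ℝ → (0,∞] a weight with 𝓛 ⊆ C₀(W), F ∈ 𝓛, and B ∈ 𝒦(𝓛,W). Assume in addition that y·|F(iy)| = o(|B(iy)|) as y → ±∞, and that ∑_{x : B(x)=0} |x|·W(x)/|B'(x)| < ∞. Then z·F(z) = ∑_{x : B(x)=0} (x·F(x)/B'(x)) · B(z)/(z−x) for all z ∈ ℂ, where the series converges locally uniformly on ℂ. -/

import Mathlib

open Filter MeasureTheory Asymptotics
open scoped ENNReal NNReal Topology

/-- A weight: a lower semicontinuous function `W : ℝ → (0,∞]` not identically `∞`. -/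
def IsWeight (W : ℝ → ℝ≥0∞) : Prop :=
  LowerSemicontinuous W ∧ (∀ x, 0 < W x) ∧ ¬ (∀ x, W x = ⊤)

/-- Membership in `C₀(W)` for an extended weight: `f : ℝ → ℂ` continuous with
`|f(x)|/W(x) → 0` as `|x| → ∞` (the quotient is taken in `ℝ≥0∞`, so it is `0`
where `W = ∞`). -/
def MemC0e (W : ℝ → ℝ≥0∞) (f : ℝ → ℂ) : Prop :=
  Continuous f ∧ Tendsto (fun x => (‖f x‖₊ : ℝ≥0∞) / W x) (cocompact ℝ) (nhds 0)

/-- The seminorm of `C₀(W)`: `‖f‖ = sup_x |f(x)|/W(x)` (computed in `ℝ≥0∞`). -/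
noncomputable def eC0norm (W : ℝ → ℝ≥0∞) (f : ℝ → ℂ) : ℝ≥0∞ :=
  ⨆ x : ℝ, (‖f x‖₊ : ℝ≥0∞) / W x

/-- An algebraic de Branges space: a linear space of entire functions, invariant
under division of zeros and under `F ↦ F^#`. -/
def IsAlgebraicDeBranges (L : Submodule ℂ (ℂ → ℂ)) : Prop :=
  (∀ F ∈ L, Differentiable ℂ F) ∧
  (∀ F ∈ L, ∀ w : ℂ, F w = 0 → ∃ G ∈ L, ∀ z : ℂ, z ≠ w → G z = F z / (z - w)) ∧
  (∀ F ∈ L, (fun z => (starRingEnd ℂ) (F ((starRingEnd ℂ) z))) ∈ L)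

/-- `𝓛 ⊆ C₀(W)`: each member of `L` restricts to an element of `C₀(W)`. -/
def SubsetC0e (W : ℝ → ℝ≥0∞) (L : Submodule ℂ (ℂ → ℂ)) : Prop :=
  ∀ F ∈ L, MemC0e W (fun x : ℝ => F (x : ℂ))

/-- Density of (the restrictions to `ℝ` of) `L` in `C₀(W)` w.r.t. the seminorm. -/
def DenseInC0e (W : ℝ → ℝ≥0∞) (L : Submodule ℂ (ℂ → ℂ)) : Prop :=
  ∀ f : ℝ → ℂ, MemC0e W f → ∀ ε : ℝ≥0∞, 0 < ε →
    ∃ F ∈ L, eC0norm W (fun x : ℝ => f x - F (x : ℂ)) < ε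

/-- The open upper half-plane. -/
def UpperHalf : Set ℂ := {z | 0 < z.im}

/-- The open lower half-plane. -/
def LowerHalf : Set ℂ := {z | z.im < 0}

/-- The (possibly meromorphic) quotient `F/G` is of bounded type on `S`:
`F/G = g₁/g₂` with `g₁, g₂` bounded and holomorphic on `S` and `g₂` not
identically zero; the identity `F/G = g₁/g₂` is expressed as `F·g₂ = G·g₁` on `S`. -/
def BddTypeQuot (S : Set ℂ) (F G : ℂ → ℂ) : Prop :=
  ∃ g₁ g₂ : ℂ → ℂ, DifferentiableOn ℂ g₁ S ∧ DifferentiableOn ℂ g₂ S ∧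
    (∃ C : ℝ, ∀ z ∈ S, ‖g₁ z‖ ≤ C) ∧ (∃ C : ℝ, ∀ z ∈ S, ‖g₂ z‖ ≤ C) ∧
    (¬ ∀ z ∈ S, g₂ z = 0) ∧ (∀ z ∈ S, F z * g₂ z = G z * g₁ z)

/-- The `W`-weighted Krein class `𝒦(𝓛,W)` with respect to `L`. -/
def KreinClass (L : Submodule ℂ (ℂ → ℂ)) (W : ℝ → ℝ≥0∞) : Set (ℂ → ℂ) :=
  {B | Differentiable ℂ B ∧
    -- (K1)
    (∃ z : ℂ, B z = 0) ∧
    (∀ z : ℂ, B z = 0 → z.im = 0 ∧ deriv B z ≠ 0) ∧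
    (∀ z : ℂ, B z = (starRingEnd ℂ) (B ((starRingEnd ℂ) z))) ∧
    -- (K2)
    (∀ F ∈ L, BddTypeQuot UpperHalf F B ∧ BddTypeQuot LowerHalf F B) ∧
    -- (K3)
    (∀ F ∈ L, (fun y : ℝ => F ((y : ℂ) * Complex.I)) =o[atTop ⊔ atBot]
        (fun y : ℝ => B ((y : ℂ) * Complex.I))) ∧
    -- (K4)
    (∑' x : {t : ℝ // B (t : ℂ) = 0}, W x.1 / (‖deriv B (x.1 : ℂ)‖₊ : ℝ≥0∞)) ≠ ⊤}

theorem lintegral_eq_lintegral_circleMap {f : ℂ → ℝ≥0∞} (hf : Measurable f) (c : ℂ) :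
    ∫⁻ p, f p = ∫⁻ s in Set.Ioi (0 : ℝ), ENNReal.ofReal s *
      ∫⁻ θ in Set.Ioo (-Real.pi) Real.pi, f (circleMap c s θ) := by
  rw [← lintegral_add_left_eq_self f c, ← Complex.lintegral_comp_polarCoord_symm]
  have h1 : ∀ p : ℝ × ℝ, c + Complex.polarCoord.symm p = circleMap c p.1 p.2 := by
    intro p
    simp [Complex.polarCoord_symm_apply, circleMap, Complex.exp_mul_I]
  simp_rw [h1]
  have h2 : Measurable fun p : ℝ × ℝ => f (circleMap c p.1 p.2) := by
    refine hf.comp ?_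
    unfold circleMap
    fun_prop
  rw [polarCoord_target, Measure.volume_eq_prod, setLIntegral_prod]
  · refine lintegral_congr fun s => ?_
    simp only [smul_eq_mul]
    rw [lintegral_const_mul]
    exact h2.comp measurable_prodMk_left
  · exact ((ENNReal.measurable_ofReal.comp measurable_fst).smul h2).aemeasurable

theorem lintegral_circleMap_eq_circleAverage {φ : ℂ → ℝ} {c : ℂ} {s : ℝ}
    (hi : CircleIntegrable φ c s) (h0 : ∀ z, 0 ≤ φ z) :
    ∫⁻ θ in Set.Ioo (-Real.pi) Real.pi, ENNReal.ofReal (φ (circleMap c s θ)) =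
      ENNReal.ofReal (2 * Real.pi * Real.circleAverage φ c s) := by
  have hper : Function.Periodic (fun θ => φ (circleMap c s θ)) (2 * Real.pi) :=
    fun x => by simp [periodic_circleMap c s x]
  have hi' : IntervalIntegrable (fun θ => φ (circleMap c s θ)) volume (-Real.pi) Real.pi := by
    have := hper.intervalIntegrable₀ Real.two_pi_pos.ne' hi (-Real.pi) Real.pi
    exact this
  have hle : -Real.pi ≤ Real.pi := by linarith [Real.pi_pos]
  have e1 : 2 * Real.pi * Real.circleAverage φ c s
      = ∫ θ in (-Real.pi)..Real.pi, φ (circleMap c s θ) := by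
    have := hper.intervalIntegral_add_eq 0 (-Real.pi)
    rw [zero_add, show -Real.pi + 2 * Real.pi = Real.pi by ring] at this
    rw [← this, Real.circleAverage_def, smul_eq_mul, ← mul_assoc,
      mul_inv_cancel₀ Real.two_pi_pos.ne', one_mul]
  rw [e1, intervalIntegral.integral_of_le hle, integral_Ioc_eq_integral_Ioo,
    ofReal_integral_eq_lintegral_ofReal]
  · exact (((intervalIntegrable_iff_integrableOn_Ioo_of_le hle).1 hi'))
  · exact Eventually.of_forall fun θ => h0 _

theorem lintegral_Ioo_ofReal {r : ℝ} (hr : 0 ≤ r) :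
    ∫⁻ s in Set.Ioo (0 : ℝ) r, ENNReal.ofReal s = ENNReal.ofReal (r ^ 2 / 2) := by
  have : ∫ s in (0 : ℝ)..r, s = r ^ 2 / 2 := by simp [integral_id]
  rw [← this, intervalIntegral.integral_of_le hr, integral_Ioc_eq_integral_Ioo,
    ofReal_integral_eq_lintegral_ofReal]
  · exact (intervalIntegrable_iff_integrableOn_Ioo_of_le hr).1
      intervalIntegral.intervalIntegrable_id
  · filter_upwards [ae_restrict_mem measurableSet_Ioo] with s hs using hs.1.le

theorem setLIntegral_ball_eq {φ : ℂ → ℝ} {c : ℂ} {R : ℝ}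
    (hφ : ContinuousOn φ (Metric.ball c R)) (h0 : ∀ z, 0 ≤ φ z) :
    ∫⁻ z in Metric.ball c R, ENNReal.ofReal (φ z) =
      ∫⁻ s in Set.Ioo (0 : ℝ) R, ENNReal.ofReal s *
        ENNReal.ofReal (2 * Real.pi * Real.circleAverage φ c s) := by
  classical
  have hm : Measurable ((Metric.ball c R).indicator fun z => ENNReal.ofReal (φ z)) := by
    rw [← Set.piecewise_eq_indicator]
    exact (ENNReal.continuous_ofReal.comp_continuousOn hφ).measurable_piecewise
      continuousOn_const Metric.isOpen_ball.measurableSet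
  rw [← lintegral_indicator Metric.isOpen_ball.measurableSet,
    lintegral_eq_lintegral_circleMap hm c, ← lintegral_indicator measurableSet_Ioi,
    ← lintegral_indicator measurableSet_Ioo]
  refine lintegral_congr fun s => ?_
  by_cases hs : 0 < s
  · rw [Set.indicator_of_mem (Set.mem_Ioi.2 hs)]
    by_cases hsR : s < R
    · rw [Set.indicator_of_mem (Set.mem_Ioo.2 ⟨hs, hsR⟩)]
      have hsub : Metric.sphere c |s| ⊆ Metric.ball c R := by
        rw [abs_of_pos hs]
        exact Metric.sphere_subset_closedBall.trans (Metric.closedBall_subset_ball hsR)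
      rw [← lintegral_circleMap_eq_circleAverage ((hφ.mono hsub).circleIntegrable') h0]
      congr 1
      refine lintegral_congr fun θ => ?_
      rw [Set.indicator_of_mem (hsub (circleMap_mem_sphere' c s θ))]
    · rw [Set.indicator_of_notMem (fun h => hsR h.2)]
      have : ∀ θ, (Metric.ball c R).indicator (fun z => ENNReal.ofReal (φ z))
          (circleMap c s θ) = 0 := fun θ => by
        refine Set.indicator_of_notMem (fun h => hsR ?_) _
        have h2 := circleMap_mem_sphere c hs.le θ
        rw [mem_sphere_iff_norm] at h2
        rw [mem_ball_iff_norm, h2] at h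
        exact h
      simp [this]
  · rw [Set.indicator_of_notMem (by simpa using hs), Set.indicator_of_notMem (fun h => hs h.1)]

theorem log_norm_le_circleAverage {f : ℂ → ℂ} {c : ℂ} {s : ℝ} (hs : 0 < s)
    (hf : AnalyticOnNhd ℂ f (Metric.closedBall c s)) (hc : f c ≠ 0) :
    Real.log ‖f c‖ ≤ Real.circleAverage (fun z => Real.log ‖f z‖) c s := by
  have hf' : AnalyticOnNhd ℂ f (Metric.closedBall c |s|) := by rwa [abs_of_pos hs]
  rw [hf'.circleAverage_log_norm hs.ne' hc]
  refine le_add_of_nonneg_left (finsum_nonneg fun u => ?_)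
  by_cases hu : u ∈ Metric.closedBall c |s|
  · refine mul_nonneg (mod_cast MeromorphicOn.AnalyticOnNhd.divisor_nonneg hf' u) ?_
    rcases eq_or_ne c u with rfl | hne
    · simp
    · refine Real.log_nonneg ?_
      have h1 : 0 < ‖c - u‖ := norm_pos_iff.2 (sub_ne_zero.2 hne)
      rw [← div_eq_mul_inv, le_div_iff₀ h1, one_mul]
      rwa [Metric.mem_closedBall, dist_comm, dist_eq_norm, abs_of_pos hs] at hu
  · simp [Function.locallyFinsuppWithin.apply_eq_zero_of_notMem _ hu]

theorem posLog_norm_le_circleAverage {f : ℂ → ℂ} {c : ℂ} {s : ℝ} (hs : 0 < s)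
    (hf : AnalyticOnNhd ℂ f (Metric.closedBall c s)) :
    Real.posLog ‖f c‖ ≤ Real.circleAverage (fun z => Real.posLog ‖f z‖) c s := by
  rcases le_or_gt ‖f c‖ 1 with h1 | h1
  · rw [(Real.posLog_eq_zero_iff _).2 (by rwa [abs_norm])]
    exact Real.circleAverage_nonneg_of_nonneg fun _ _ => Real.posLog_nonneg
  · rw [Real.posLog_eq_log (by rw [abs_norm]; exact h1.le)]
    have hsub : Metric.sphere c |s| ⊆ Metric.closedBall c s := by
      rw [abs_of_pos hs]; exact Metric.sphere_subset_closedBall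
    refine (log_norm_le_circleAverage hs hf (norm_pos_iff.1 (one_pos.trans h1))).trans ?_
    refine Real.circleAverage_mono (hf.mono hsub).meromorphicOn.circleIntegrable_log_norm ?_ ?_
    · exact (Real.continuous_posLog.comp_continuousOn
        (hf.mono hsub).continuousOn.norm).circleIntegrable'
    · intro z _
      exact le_max_right _ _

theorem circleAverage_posLog_le_neg_log {f g : ℂ → ℂ} {c : ℂ} {s : ℝ} (hs : 0 < s)
    (hf : AnalyticOnNhd ℂ f (Metric.closedBall c s))
    (hg : AnalyticOnNhd ℂ g (Metric.closedBall c s)) (hc : g c ≠ 0)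
    (hg1 : ∀ z ∈ Metric.closedBall c s, ‖g z‖ ≤ 1)
    (hfg : ∀ z ∈ Metric.closedBall c s, ‖f z * g z‖ ≤ 1) :
    Real.circleAverage (fun z => Real.posLog ‖f z‖) c s ≤ -Real.log ‖g c‖ := by
  classical
  have hsub : Metric.sphere c |s| ⊆ Metric.closedBall c s := by
    rw [abs_of_pos hs]; exact Metric.sphere_subset_closedBall
  have hcod : (fun z => Real.posLog ‖f z‖) =ᶠ[codiscreteWithin (Metric.sphere c |s|)]
      fun z => if g z = 0 then 0 else Real.posLog ‖f z‖ := by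
    have := hg.preimage_zero_mem_codiscreteWithin hc (Metric.mem_closedBall_self hs.le)
      ((convex_closedBall c s).isConnected ⟨c, Metric.mem_closedBall_self hs.le⟩)
    filter_upwards [codiscreteWithin_mono hsub this] with z hz
    have : g z ≠ 0 := by simpa using hz
    simp [this]
  have hint : CircleIntegrable (fun z => Real.posLog ‖f z‖) c s :=
    (Real.continuous_posLog.comp_continuousOn
        (hf.mono hsub).continuousOn.norm).circleIntegrable'
  rw [Real.circleAverage_congr_codiscreteWithin hcod hs.ne']
  have hlog : CircleIntegrable (fun z => Real.log ‖g z‖) c s :=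
    (hg.mono hsub).meromorphicOn.circleIntegrable_log_norm
  have h2 : Real.circleAverage (fun z => -Real.log ‖g z‖) c s ≤ -Real.log ‖g c‖ := by
    have h3 := log_norm_le_circleAverage hs hg hc
    have h4 : Real.circleAverage (fun z => -Real.log ‖g z‖) c s
        = -Real.circleAverage (fun z => Real.log ‖g z‖) c s := by
      simpa using Real.circleAverage_fun_smul (a := (-1 : ℝ)) (f := fun z => Real.log ‖g z‖)
        (c := c) (R := s)
    rw [h4]
    exact neg_le_neg h3
  refine le_trans (Real.circleAverage_mono (hint.congr_codiscreteWithin hcod) hlog.neg ?_) h2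
  intro z hz
  have hz := hsub hz
  by_cases h0 : g z = 0
  · simp [h0]
  · have hgpos : 0 < ‖g z‖ := norm_pos_iff.2 h0
    simp only [h0, if_false]
    refine max_le ?_ ?_
    · simpa using Real.log_nonpos hgpos.le (hg1 z hz)
    · rcases eq_or_ne (f z) 0 with h5 | h5
      · simpa [h5] using Real.log_nonpos hgpos.le (hg1 z hz)
      · have := hfg z hz
        rw [norm_mul] at this
        have h6 := Real.log_nonpos (by positivity) this
        rw [Real.log_mul (norm_ne_zero_iff.2 h5) hgpos.ne'] at h6
        change Real.log ‖f z‖ ≤ -Real.log ‖g z‖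
        linarith

/-- A pointwise bound for a quotient of bounded analytic functions on the unit disc. -/
theorem posLog_norm_le_of_mul_bounded {f g : ℂ → ℂ}
    (hf : DifferentiableOn ℂ f (Metric.ball 0 1)) (hg : DifferentiableOn ℂ g (Metric.ball 0 1))
    (h0 : g 0 ≠ 0) (hg1 : ∀ z ∈ Metric.ball (0 : ℂ) 1, ‖g z‖ ≤ 1)
    (hfg : ∀ z ∈ Metric.ball (0 : ℂ) 1, ‖f z * g z‖ ≤ 1) {w : ℂ} (hw : ‖w‖ < 1) :
    Real.posLog ‖f w‖ * (1 - ‖w‖) ^ 2 ≤ -Real.log ‖g 0‖ := by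
  set V := -Real.log ‖g 0‖ with hV
  have hV0 : 0 ≤ V := by
    have := Real.log_nonpos (norm_nonneg _) (hg1 0 (by simp))
    linarith
  have hfa := hf.analyticOnNhd Metric.isOpen_ball
  have hga := hg.analyticOnNhd Metric.isOpen_ball
  set δ := 1 - ‖w‖ with hδ
  have hδ0 : 0 < δ := by linarith
  set φ : ℂ → ℝ := fun z => Real.posLog ‖f z‖ with hφ
  have hφ0 : ∀ z, 0 ≤ φ z := fun z => Real.posLog_nonneg
  have hφc : ContinuousOn φ (Metric.ball 0 1) :=
    Real.continuous_posLog.comp_continuousOn hf.continuousOn.norm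
  have hsub : Metric.ball w δ ⊆ Metric.ball 0 1 := by
    refine Metric.ball_subset_ball' ?_
    simp [hδ]
  have h1 : ∫⁻ z in Metric.ball w δ, ENNReal.ofReal (φ z)
      ≤ ∫⁻ z in Metric.ball 0 1, ENNReal.ofReal (φ z) := lintegral_mono_set hsub
  rw [setLIntegral_ball_eq (hφc.mono hsub) hφ0, setLIntegral_ball_eq hφc hφ0] at h1
  have hlow : ENNReal.ofReal (δ ^ 2 / 2) * ENNReal.ofReal (2 * Real.pi * φ w) ≤
      ∫⁻ s in Set.Ioo (0 : ℝ) δ, ENNReal.ofReal s *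
        ENNReal.ofReal (2 * Real.pi * Real.circleAverage φ w s) := by
    rw [← lintegral_Ioo_ofReal hδ0.le, ← lintegral_mul_const _ ENNReal.measurable_ofReal]
    refine setLIntegral_mono' measurableSet_Ioo fun s hs => ?_
    gcongr
    exact posLog_norm_le_circleAverage hs.1
      (hfa.mono ((Metric.closedBall_subset_ball hs.2).trans hsub))
  have hup : ∫⁻ s in Set.Ioo (0 : ℝ) 1, ENNReal.ofReal s *
        ENNReal.ofReal (2 * Real.pi * Real.circleAverage φ 0 s) ≤
      ENNReal.ofReal (1 ^ 2 / 2) * ENNReal.ofReal (2 * Real.pi * V) := by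
    rw [← lintegral_Ioo_ofReal zero_le_one, ← lintegral_mul_const _ ENNReal.measurable_ofReal]
    refine setLIntegral_mono' measurableSet_Ioo fun s hs => ?_
    have hs1 := Metric.closedBall_subset_ball (x := (0 : ℂ)) hs.2
    gcongr
    exact circleAverage_posLog_le_neg_log hs.1 (hfa.mono hs1) (hga.mono hs1) h0
      (fun z hz => hg1 z (hs1 hz)) (fun z hz => hfg z (hs1 hz))
  have h2 := (hlow.trans h1).trans hup
  rw [← ENNReal.ofReal_mul (by positivity), ← ENNReal.ofReal_mul (by positivity),
    ENNReal.ofReal_le_ofReal_iff (by positivity)] at h2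
  nlinarith [Real.pi_pos]

open ComplexConjugate in
/-- A pointwise bound for a quotient of bounded analytic functions on the upper half-plane. -/
theorem posLog_norm_le_of_mul_bounded_upperHalf {f g : ℂ → ℂ}
    (hf : DifferentiableOn ℂ f UpperHalf) (hg : DifferentiableOn ℂ g UpperHalf)
    (hg1 : ∀ z ∈ UpperHalf, ‖g z‖ ≤ 1) (hfg : ∀ z ∈ UpperHalf, ‖f z * g z‖ ≤ 1)
    {z₀ z : ℂ} (hz₀ : 0 < z₀.im) (hz : 0 < z.im) (h0 : g z₀ ≠ 0) :
    Real.posLog ‖f z‖ * (2 * z.im * z₀.im / Complex.normSq (z - conj z₀)) ^ 2 ≤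
      -Real.log ‖g z₀‖ := by
  set ψ : ℂ → ℂ := fun w => (z₀ - conj z₀ * w) / (1 - w) with hψ
  have hne : ∀ w ∈ Metric.ball (0 : ℂ) 1, 1 - w ≠ 0 := by
    intro w hw h
    rw [← sub_eq_zero.1 h] at hw
    simp at hw
  have hmaps : Set.MapsTo ψ (Metric.ball (0 : ℂ) 1) UpperHalf := by
    intro w hw
    have h1 := hne w hw
    have h2 : 0 < Complex.normSq (1 - w) := Complex.normSq_pos.2 h1
    have h3 : w.re * w.re + w.im * w.im < 1 := by
      rw [← Complex.normSq_apply, Complex.normSq_eq_norm_sq]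
      have : ‖w‖ < 1 := by simpa using hw
      have := norm_nonneg w
      nlinarith
    have h4 : (ψ w).im = z₀.im * (1 - (w.re * w.re + w.im * w.im)) / Complex.normSq (1 - w) := by
      simp only [hψ, Complex.div_im, Complex.sub_re, Complex.sub_im, Complex.mul_re,
        Complex.mul_im, Complex.conj_re, Complex.conj_im, Complex.one_re, Complex.one_im]
      field_simp
      ring
    change 0 < (ψ w).im
    rw [h4]
    exact div_pos (mul_pos hz₀ (by linarith)) h2
  have hψd : DifferentiableOn ℂ ψ (Metric.ball 0 1) :=
    DifferentiableOn.div (by fun_prop) (by fun_prop) hne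
  have hzne : z - conj z₀ ≠ 0 := by
    intro h
    have := congrArg Complex.im h
    simp at this
    linarith
  have hz₀ne : z₀ - conj z₀ ≠ 0 := by
    intro h
    have := congrArg Complex.im h
    simp at this
    linarith
  set N := Complex.normSq (z - conj z₀) with hN
  have hNpos : 0 < N := Complex.normSq_pos.2 hzne
  set w := (z - z₀) / (z - conj z₀) with hw
  have hw2 : 1 - ‖w‖ ^ 2 = 4 * z.im * z₀.im / N := by
    rw [← Complex.normSq_eq_norm_sq, hw, Complex.normSq_div, ← hN, eq_div_iff hNpos.ne', sub_mul,
      div_mul_cancel₀ _ hNpos.ne', hN]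
    simp only [Complex.normSq_apply, Complex.sub_re, Complex.sub_im, Complex.conj_re,
      Complex.conj_im]
    ring
  have hpos : 0 < 4 * z.im * z₀.im / N := by positivity
  have hw1 : ‖w‖ < 1 := by
    have := norm_nonneg w
    nlinarith
  have hψw : ψ w = z := by
    have h1 : 1 - w = (z₀ - conj z₀) / (z - conj z₀) := by
      rw [hw]; field_simp; ring
    have h2 : z₀ - conj z₀ * w = z * (z₀ - conj z₀) / (z - conj z₀) := by
      rw [hw]; field_simp; ring
    simp only [hψ]
    rw [h1, h2]
    field_simp
  have key := posLog_norm_le_of_mul_bounded (f := f ∘ ψ) (g := g ∘ ψ) (hf.comp hψd hmaps)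
    (hg.comp hψd hmaps) (by simpa [hψ] using h0) (fun z hz => hg1 _ (hmaps hz))
    (fun z hz => hfg _ (hmaps hz)) hw1
  simp only [Function.comp_apply, hψw] at key
  have e0 : ψ 0 = z₀ := by simp [hψ]
  rw [e0] at key
  refine le_trans ?_ key
  refine mul_le_mul_of_nonneg_left ?_ Real.posLog_nonneg
  have h5 : 2 * z.im * z₀.im / N ≤ 1 - ‖w‖ := by
    have : 2 * z.im * z₀.im / N = (1 - ‖w‖ ^ 2) / 2 := by rw [hw2]; ring
    rw [this]
    nlinarith [norm_nonneg w]
  gcongr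

/-- A bounded analytic function on the upper half-plane which decays exponentially along the
imaginary axis decays exponentially in the whole half-plane. -/
theorem norm_le_exp_of_exp_decay_imaginary_axis {N : ℂ → ℂ} {a C : ℝ}
    (hN : DifferentiableOn ℂ N UpperHalf) (hN1 : ∀ z ∈ UpperHalf, ‖N z‖ ≤ 1)
    (hdec : ∀ᶠ y : ℝ in atTop, ‖N (y * Complex.I)‖ ≤ C * Real.exp (-a * y))
    {z : ℂ} (hz : 0 < z.im) : ‖N z‖ ≤ Real.exp (-a * z.im) := by
  have hstep : ∀ η : ℝ, 0 < η → ∀ w : ℂ, 0 ≤ w.im →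
      ‖N (w + η * Complex.I)‖ ≤ Real.exp (-a * w.im) := by
    intro η hη w hw
    set g : ℂ → ℂ := fun ζ => N (Complex.I * ζ + η * Complex.I) * Complex.exp (a * ζ) with hg
    have him : ∀ ζ : ℂ, (Complex.I * ζ + η * Complex.I).im = ζ.re + η := by
      intro ζ; simp
    have hopen : IsOpen UpperHalf := isOpen_lt continuous_const Complex.continuous_im
    have hnorm : ∀ ζ : ℂ, ‖g ζ‖ = ‖N (Complex.I * ζ + η * Complex.I)‖ * Real.exp (a * ζ.re) := by
      intro ζ
      simp [hg, Complex.norm_exp]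
    have hgd : ∀ ζ : ℂ, 0 ≤ ζ.re → DifferentiableAt ℂ g ζ := by
      intro ζ hζ
      have : Complex.I * ζ + η * Complex.I ∈ UpperHalf := by
        change 0 < (Complex.I * ζ + η * Complex.I).im; rw [him]; linarith
      have h1 := hN.differentiableAt (hopen.mem_nhds this)
      have h2 : DifferentiableAt ℂ (fun ζ : ℂ => Complex.I * ζ + η * Complex.I) ζ := by fun_prop
      exact (DifferentiableAt.comp (g := N) ζ h1 h2).mul (by fun_prop)
    have hgcl : DiffContOnCl ℂ g {z | 0 < z.re} := by
      refine DifferentiableOn.diffContOnCl fun ζ hζ => ?_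
      have : closure {z : ℂ | 0 < z.re} ⊆ {z | 0 ≤ z.re} :=
        closure_minimal (fun z (hz : 0 < z.re) => (hz.le : 0 ≤ z.re))
          (isClosed_le continuous_const Complex.continuous_re)
      exact (hgd ζ (this hζ)).differentiableWithinAt
    have hgle : ∀ ζ : ℂ, 0 ≤ ζ.re → ‖g ζ‖ ≤ Real.exp (a * ζ.re) := by
      intro ζ hζ
      rw [hnorm]
      refine mul_le_of_le_one_left (Real.exp_pos _).le (hN1 _ ?_)
      change 0 < (Complex.I * ζ + η * Complex.I).im; rw [him]; linarith
    have := PhragmenLindelof.right_half_plane_of_bounded_on_real (f := g) (C := 1)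
      (z := -Complex.I * w) hgcl ⟨1, one_lt_two, |a|, ?_⟩ ?_ ?_ (by simpa using hw)
    · rw [hnorm] at this
      have e : Complex.I * (-Complex.I * w) = w := by
        rw [← mul_assoc]; simp
      rw [e] at this
      rw [neg_mul, Real.exp_neg]
      have e2 : (-Complex.I * w).re = w.im := by simp
      rw [e2] at this
      rwa [← one_div, le_div_iff₀ (Real.exp_pos _)]
    · refine Asymptotics.IsBigO.of_bound 1 ?_
      refine (eventually_inf_principal.2 (Eventually.of_forall fun ζ hζ => ?_))
      rw [one_mul, Real.norm_of_nonneg (Real.exp_pos _).le, Real.rpow_one]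
      refine (hgle ζ (le_of_lt hζ)).trans (Real.exp_le_exp.2 ?_)
      calc a * ζ.re ≤ |a * ζ.re| := le_abs_self _
        _ = |a| * |ζ.re| := abs_mul _ _
        _ ≤ |a| * ‖ζ‖ := by gcongr; exact Complex.abs_re_le_norm ζ
    · refine ⟨|C| * Real.exp (-a * η), ?_⟩
      rw [eventually_map]
      have h3 := (tendsto_atTop_add_const_right atTop η tendsto_id).eventually hdec
      filter_upwards [h3] with x hx
      rw [hnorm]
      have e : Complex.I * (x : ℂ) + η * Complex.I = ((x + η : ℝ) : ℂ) * Complex.I := by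
        push_cast; ring
      rw [e]
      calc _ ≤ C * Real.exp (-a * (x + η)) * Real.exp (a * x) := by
            exact mul_le_mul_of_nonneg_right hx (Real.exp_pos _).le
        _ = C * Real.exp (-a * η) := by
            rw [mul_assoc, ← Real.exp_add]; congr 2; ring
        _ ≤ _ := by gcongr; exact le_abs_self C
    · intro x
      refine (hgle _ (by simp)).trans ?_
      simp
  have hlim : Tendsto (fun η : ℝ => Real.exp (-a * (z.im - η))) (𝓝[>] 0)
      (𝓝 (Real.exp (-a * z.im))) := by
    have : Continuous fun η : ℝ => Real.exp (-a * (z.im - η)) := by fun_prop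
    simpa using (this.tendsto 0).mono_left nhdsWithin_le_nhds
  refine ge_of_tendsto hlim ?_
  filter_upwards [Ioo_mem_nhdsGT hz] with η hη
  have := hstep η hη.1 (z - η * Complex.I) (by simpa using hη.2.le)
  simpa using this

/-- A bounded analytic function on the upper half-plane without exponential decay takes values
which are not exponentially small in a fixed sector, at every large radius. -/
theorem exists_exp_le_norm_of_forall_not_exp_decay {G : ℂ → ℂ}
    (hG : DifferentiableOn ℂ G UpperHalf) (hG1 : ∀ z ∈ UpperHalf, ‖G z‖ ≤ 1)
    (hno : ∀ a : ℝ, 0 < a → ∃ z ∈ UpperHalf, Real.exp (-a * z.im) < ‖G z‖)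
    {ε : ℝ} (hε : 0 < ε) :
    ∃ R₀ : ℝ, ∀ R ≥ R₀, ∃ z : ℂ, ‖z‖ = R ∧ 0 < z.im ∧ R ^ 2 / 2 ≤ z.im ^ 2 ∧
      Real.exp (-(ε * R)) ≤ ‖G z‖ := by
  by_contra! hcon
  have hopen : IsOpen UpperHalf := isOpen_lt continuous_const Complex.continuous_im
  have hbad : ∀ R : ℝ, 0 < R → (∀ z : ℂ, ‖z‖ = R → 0 < z.im → R ^ 2 / 2 ≤ z.im ^ 2 →
      ‖G z‖ < Real.exp (-(ε * R))) → ∀ z : ℂ, ‖z‖ < R → 0 < z.im →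
      ‖G z‖ ≤ Real.exp (-(ε / 2 * (z - z ^ 3 / R ^ 2).im)) := by
    intro R hR hb z hzR hz
    set Φ : ℂ → ℂ := fun ζ => G ζ * Complex.exp (-Complex.I * (ε / 2 * (ζ - ζ ^ 3 / R ^ 2)))
      with hΦ
    have hnorm : ∀ ζ, ‖Φ ζ‖ = ‖G ζ‖ * Real.exp (ε / 2 * (ζ - ζ ^ 3 / R ^ 2).im) := by
      intro ζ
      have e : (-Complex.I * ((ε : ℂ) / 2 * (ζ - ζ ^ 3 / R ^ 2))).re
          = ε / 2 * (ζ - ζ ^ 3 / R ^ 2).im := by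
        rw [show (ε : ℂ) / 2 = ((ε / 2 : ℝ) : ℂ) by push_cast; ring, neg_mul, Complex.neg_re,
          Complex.I_mul_re, Complex.im_ofReal_mul, neg_neg]
      rw [hΦ]
      simp only [norm_mul, Complex.norm_exp, e]
    have him : ∀ ζ : ℂ, (ζ - ζ ^ 3 / R ^ 2).im
        = ζ.im - (3 * ζ.re ^ 2 * ζ.im - ζ.im ^ 3) / R ^ 2 := by
      intro ζ
      rw [Complex.sub_im, show (R : ℂ) ^ 2 = ((R ^ 2 : ℝ) : ℂ) by push_cast; ring,
        Complex.div_ofReal_im]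
      congr 2
      simp only [pow_succ, pow_zero, one_mul, Complex.mul_im, Complex.mul_re]
      ring
    have hη : ∀ η : ℝ, 0 < η → η < z.im → ‖Φ z‖ ≤ Real.exp (ε * η) := by
      intro η hη hηz
      set U : Set ℂ := Metric.ball 0 R ∩ {ζ | η < ζ.im} with hU
      have hUo : IsOpen U :=
        Metric.isOpen_ball.inter (isOpen_lt continuous_const Complex.continuous_im)
      have hcl : ∀ ζ ∈ closure U, ‖ζ‖ ≤ R ∧ η ≤ ζ.im := by
        have : IsClosed {ζ : ℂ | ‖ζ‖ ≤ R ∧ η ≤ ζ.im} :=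
          (isClosed_le continuous_norm continuous_const).inter
            (isClosed_le continuous_const Complex.continuous_im)
        have h2 : U ⊆ {ζ : ℂ | ‖ζ‖ ≤ R ∧ η ≤ ζ.im} := by
          rintro ζ ⟨h1, h2⟩
          have h1 : ‖ζ‖ < R := by simpa using h1
          have h2 : η < ζ.im := h2
          exact ⟨h1.le, h2.le⟩
        exact fun ζ hζ => closure_minimal h2 this hζ
      have hd : DiffContOnCl ℂ Φ U := by
        refine DifferentiableOn.diffContOnCl ?_
        refine DifferentiableOn.mul (hG.mono fun ζ hζ => ?_) (by fun_prop)
        exact hη.trans_le (hcl ζ hζ).2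
      refine Complex.norm_le_of_forall_mem_frontier_norm_le (U := U)
        (Metric.isBounded_ball.subset Set.inter_subset_left) hd ?_
        (subset_closure ⟨by simpa using hzR, hηz⟩)
      intro ζ hζ
      rw [frontier, hUo.interior_eq] at hζ
      obtain ⟨h1, h2⟩ := hcl ζ hζ.1
      have hG1' := hG1 ζ (hη.trans_le h2)
      have hηR : η ≤ R := (hηz.trans_le ((Complex.abs_im_le_norm z).trans' (le_abs_self _))).le.trans
        hzR.le
      rw [hnorm, him]
      rcases h2.eq_or_lt with h3 | h3
      · calc _ ≤ 1 * Real.exp (ε * η) := by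
              gcongr ?_ * Real.exp ?_
              have h4 : -(3 * ζ.re ^ 2 * ζ.im - ζ.im ^ 3) / R ^ 2 ≤ η := by
                rw [div_le_iff₀ (by positivity), ← h3]
                have : η ^ 2 ≤ R ^ 2 := by gcongr
                nlinarith [mul_nonneg (sq_nonneg ζ.re) hη.le]
              rw [neg_div] at h4
              nlinarith
          _ = _ := one_mul _
      · have h4 : ‖ζ‖ = R := by
          refine h1.antisymm ?_
          by_contra! h5
          exact hζ.2 ⟨by simpa using h5, h3⟩
        have hy : 0 < ζ.im := hη.trans h3
        have h5 : ζ.re ^ 2 = R ^ 2 - ζ.im ^ 2 := by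
          have := Complex.normSq_eq_norm_sq ζ
          rw [Complex.normSq_apply, h4] at this
          linarith
        have h6 : ζ.im - (3 * ζ.re ^ 2 * ζ.im - ζ.im ^ 3) / R ^ 2
            = 4 * ζ.im / R ^ 2 * (ζ.im ^ 2 - R ^ 2 / 2) := by
          rw [h5]; field_simp; ring
        have hyR : ζ.im ≤ R := h4 ▸ (le_abs_self _).trans (Complex.abs_im_le_norm ζ)
        refine le_trans ?_ (Real.one_le_exp (by positivity : 0 ≤ ε * η))
        rcases le_or_gt (R ^ 2 / 2) (ζ.im ^ 2) with h7 | h7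
        · have h8 : ζ.im - (3 * ζ.re ^ 2 * ζ.im - ζ.im ^ 3) / R ^ 2 ≤ 2 * R := by
            rw [h6]
            calc _ ≤ 4 * R / R ^ 2 * (R ^ 2 - R ^ 2 / 2) := by gcongr
              _ = 2 * R := by field_simp; ring
          calc _ ≤ Real.exp (-(ε * R)) * Real.exp (ε / 2 * (2 * R)) := by
                gcongr
                exact (hb ζ h4 hy h7).le
            _ = 1 := by rw [← Real.exp_add]; simp; ring
        · refine mul_le_one₀ hG1' (Real.exp_pos _).le (Real.exp_le_one_iff.2 ?_)
          rw [h6]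
          refine mul_nonpos_of_nonneg_of_nonpos (by positivity)
            (mul_nonpos_of_nonneg_of_nonpos (by positivity) (by linarith))
    have hlim : Tendsto (fun η : ℝ => Real.exp (ε * η)) (𝓝[>] 0) (𝓝 1) := by
      have : Continuous fun η : ℝ => Real.exp (ε * η) := by fun_prop
      simpa using (this.tendsto 0).mono_left nhdsWithin_le_nhds
    have h1 : ‖Φ z‖ ≤ 1 := by
      refine ge_of_tendsto hlim ?_
      filter_upwards [Ioo_mem_nhdsGT hz] with η h using hη η h.1 h.2
    rw [hnorm] at h1
    rwa [Real.exp_neg, ← one_div, le_div_iff₀ (Real.exp_pos _)]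
  obtain ⟨z, hz, hGz⟩ := hno (ε / 2) (by positivity)
  refine hGz.not_ge ?_
  have hz : 0 < z.im := hz
  have hlim : Tendsto (fun R : ℝ => Real.exp (-(ε / 2 * (z - z ^ 3 / R ^ 2).im))) atTop
      (𝓝 (Real.exp (-(ε / 2) * z.im))) := by
    have h1 : Tendsto (fun R : ℝ => (R ^ 2)⁻¹) atTop (𝓝 0) :=
      tendsto_inv_atTop_zero.comp (tendsto_pow_atTop two_ne_zero)
    have h2 : ∀ R : ℝ, (z - z ^ 3 / R ^ 2).im = z.im - (z ^ 3).im * (R ^ 2)⁻¹ := by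
      intro R
      rw [Complex.sub_im, show (R : ℂ) ^ 2 = ((R ^ 2 : ℝ) : ℂ) by push_cast; ring,
        Complex.div_ofReal_im, div_eq_mul_inv]
    simp_rw [h2]
    have h3 : Continuous fun t : ℝ => Real.exp (-(ε / 2 * (z.im - (z ^ 3).im * t))) := by fun_prop
    have h4 := (h3.tendsto 0).comp h1
    simpa [Function.comp_def] using h4
  refine ge_of_tendsto_of_frequently hlim ?_
  rw [frequently_atTop]
  intro R₀
  obtain ⟨R, hR, hb⟩ := hcon (max R₀ (‖z‖ + 1))
  have hR' : ‖z‖ < R := by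
    have := (le_max_right R₀ (‖z‖ + 1)).trans hR
    linarith
  exact ⟨R, (le_max_left _ _).trans hR, hbad R ((norm_nonneg z).trans_lt hR') hb z hR' hz⟩

open ComplexConjugate in
/-- A quotient of bounded analytic functions on the upper half-plane which is bounded along the
imaginary axis has sub-exponential growth away from the real axis. -/
theorem norm_le_exp_of_mul_eq_of_bounded_imaginary_axis {f G N : ℂ → ℂ} {M : ℝ}
    (hf : DifferentiableOn ℂ f UpperHalf) (hG : DifferentiableOn ℂ G UpperHalf)
    (hN : DifferentiableOn ℂ N UpperHalf) (hG1 : ∀ z ∈ UpperHalf, ‖G z‖ ≤ 1)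
    (hN1 : ∀ z ∈ UpperHalf, ‖N z‖ ≤ 1) (hfG : ∀ z ∈ UpperHalf, f z * G z = N z)
    (hG0 : ∃ z ∈ UpperHalf, G z ≠ 0) (hM : ∀ᶠ y : ℝ in atTop, ‖f (y * Complex.I)‖ ≤ M)
    {ε : ℝ} (hε : 0 < ε) :
    ∃ R₀ : ℝ, ∀ R ≥ R₀, ∀ z : ℂ, 0 < z.im → ‖z‖ ≤ R →
      ‖f z‖ ≤ Real.exp (ε * R ^ 3 / z.im ^ 2) := by
  obtain ⟨z₁, hz₁, hGz₁⟩ := hG0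
  have hz₁ : 0 < z₁.im := hz₁
  set A : Set ℝ := {a | ∀ z ∈ UpperHalf, ‖G z‖ ≤ Real.exp (-a * z.im)} with hA
  have hle : ∀ a ∈ A, ∀ z ∈ UpperHalf, G z ≠ 0 → a ≤ -Real.log ‖G z‖ / z.im := by
    intro a ha z hz h0
    have hz' : 0 < z.im := hz
    rw [le_div_iff₀ hz', le_neg, Real.log_le_iff_le_exp (norm_pos_iff.2 h0), ← neg_mul]
    exact ha z hz
  have hA0 : (0 : ℝ) ∈ A := fun z hz => by simpa using hG1 z hz
  have hAb : BddAbove A := ⟨_, fun a ha => hle a ha z₁ hz₁ hGz₁⟩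
  set a₀ := sSup A with ha₀
  have ha₀A : a₀ ∈ A := by
    intro z hz
    by_cases h0 : G z = 0
    · simp [h0, (Real.exp_pos _).le]
    · have hz' : 0 < z.im := hz
      have := csSup_le ⟨0, hA0⟩ fun a ha => hle a ha z hz h0
      rw [le_div_iff₀ hz', le_neg, Real.log_le_iff_le_exp (norm_pos_iff.2 h0), ← neg_mul] at this
      exact this
  have hnexp : ∀ z : ℂ, ‖Complex.exp (-Complex.I * (a₀ * z))‖ = Real.exp (a₀ * z.im) := by
    intro z
    rw [Complex.norm_exp, neg_mul, Complex.neg_re, Complex.I_mul_re, Complex.im_ofReal_mul, neg_neg]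
  have hcancel : ∀ z : ℂ, Real.exp (-a₀ * z.im) * Real.exp (a₀ * z.im) = 1 := by
    intro z
    rw [← Real.exp_add]; simp
  set G' : ℂ → ℂ := fun z => G z * Complex.exp (-Complex.I * (a₀ * z)) with hG'
  have hnG' : ∀ z, ‖G' z‖ = ‖G z‖ * Real.exp (a₀ * z.im) := by
    intro z; simp only [hG', norm_mul, hnexp]
  have hG'd : DifferentiableOn ℂ G' UpperHalf := hG.mul (by fun_prop)
  have hG'1 : ∀ z ∈ UpperHalf, ‖G' z‖ ≤ 1 := by
    intro z hz
    rw [hnG', ← hcancel z]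
    gcongr
    exact ha₀A z hz
  have hNa : ∀ z ∈ UpperHalf, ‖N z‖ ≤ Real.exp (-a₀ * z.im) := by
    intro z hz
    refine norm_le_exp_of_exp_decay_imaginary_axis (C := M) hN hN1 ?_ hz
    filter_upwards [hM, eventually_gt_atTop 0] with y hy hy0
    have hmem : (y : ℂ) * Complex.I ∈ UpperHalf := by
      change 0 < ((y : ℂ) * Complex.I).im
      simpa using hy0
    rw [← hfG _ hmem, norm_mul]
    have h1 := ha₀A _ hmem
    simp only [Complex.mul_im, Complex.ofReal_re, Complex.I_im, Complex.ofReal_im, Complex.I_re,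
      mul_one, mul_zero, add_zero] at h1
    exact mul_le_mul hy h1 (norm_nonneg _) ((norm_nonneg _).trans hy)
  have hfG' : ∀ z ∈ UpperHalf, ‖f z * G' z‖ ≤ 1 := by
    intro z hz
    have : f z * G' z = N z * Complex.exp (-Complex.I * (a₀ * z)) := by
      rw [← hfG z hz, hG', mul_assoc]
    rw [this, norm_mul, hnexp, ← hcancel z]
    gcongr
    exact hNa z hz
  have hno : ∀ a : ℝ, 0 < a → ∃ z ∈ UpperHalf, Real.exp (-a * z.im) < ‖G' z‖ := by
    intro a ha
    by_contra! hcon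
    have : a + a₀ ∈ A := by
      intro z hz
      have h1 := hcon z hz
      rw [hnG'] at h1
      calc ‖G z‖ = ‖G z‖ * Real.exp (a₀ * z.im) * Real.exp (-a₀ * z.im) := by
            rw [mul_assoc, ← Real.exp_add]; simp
        _ ≤ Real.exp (-a * z.im) * Real.exp (-a₀ * z.im) := by gcongr
        _ = _ := by rw [← Real.exp_add]; congr 1; ring
    have := le_csSup hAb this
    linarith
  obtain ⟨R₀, hR₀⟩ := exists_exp_le_norm_of_forall_not_exp_decay hG'd hG'1 hno
    (show 0 < ε / 8 by positivity)
  refine ⟨max R₀ 1, fun R hR z hz hzR => ?_⟩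
  have hR1 : 0 < R := one_pos.trans_le ((le_max_right _ _).trans hR)
  obtain ⟨z₀, hz₀R, hz₀, hz₀2, hGz₀⟩ := hR₀ R ((le_max_left _ _).trans hR)
  have hG'z₀ : 0 < ‖G' z₀‖ := (Real.exp_pos _).trans_le hGz₀
  have key := posLog_norm_le_of_mul_bounded_upperHalf hf hG'd hG'1 hfG' hz₀ hz
    (norm_pos_iff.1 hG'z₀)
  have h1 : -Real.log ‖G' z₀‖ ≤ ε / 8 * R := by
    rw [neg_le, Real.le_log_iff_exp_le hG'z₀]
    exact hGz₀
  set P := Real.posLog ‖f z‖ with hP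
  have hP0 : 0 ≤ P := Real.posLog_nonneg
  set Q := Complex.normSq (z - conj z₀) with hQ
  have hQpos : 0 < Q := by
    refine Complex.normSq_pos.2 fun h => ?_
    have := congrArg Complex.im h
    simp at this
    linarith
  have hQle : Q ≤ 4 * R ^ 2 := by
    rw [hQ, Complex.normSq_eq_norm_sq]
    have : ‖z - conj z₀‖ ≤ R + R := by
      refine (norm_sub_le _ _).trans (add_le_add hzR ?_)
      rw [Complex.norm_conj, hz₀R]
    calc _ ≤ (R + R) ^ 2 := by gcongr
      _ = _ := by ring
  have h2 : P * (2 * z.im * z₀.im / Q) ^ 2 ≤ ε / 8 * R := key.trans h1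
  rw [div_pow, mul_div_assoc', div_le_iff₀ (by positivity)] at h2
  have h3 : P * (2 * z.im ^ 2 * R ^ 2) ≤ ε / 8 * R * (4 * R ^ 2) ^ 2 :=
    calc P * (2 * z.im ^ 2 * R ^ 2) = P * (4 * z.im ^ 2 * (R ^ 2 / 2)) := by ring
      _ ≤ P * (4 * z.im ^ 2 * z₀.im ^ 2) := by gcongr
      _ = P * (2 * z.im * z₀.im) ^ 2 := by ring
      _ ≤ _ := h2
      _ ≤ _ := by gcongr
  have h4 : P ≤ ε * R ^ 3 / z.im ^ 2 := by
    rw [le_div_iff₀ (by positivity)]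
    have h5 : 0 < 2 * R ^ 2 := by positivity
    refine le_of_mul_le_mul_right ?_ h5
    calc _ = P * (2 * z.im ^ 2 * R ^ 2) := by ring
      _ ≤ _ := h3
      _ = _ := by ring
  rcases (norm_nonneg (f z)).eq_or_lt with h5 | h5
  · rw [← h5]; exact (Real.exp_pos _).le
  · rw [← Real.log_le_iff_le_exp h5]
    exact (le_max_right _ _).trans h4

theorem norm_mul_div_le_exp_of_bddTypeQuot {F B : ℂ → ℂ} {M : ℝ} (hF : Differentiable ℂ F)
    (hB : Differentiable ℂ B) (hB0 : ∀ z ∈ UpperHalf, B z ≠ 0) (hq : BddTypeQuot UpperHalf F B)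
    (hM : ∀ᶠ y : ℝ in atTop,
      ‖(y * Complex.I) * F (y * Complex.I) / B (y * Complex.I)‖ ≤ M)
    {ε : ℝ} (hε : 0 < ε) :
    ∃ R₀ : ℝ, ∀ R ≥ R₀, ∀ z : ℂ, 0 < z.im → ‖z‖ ≤ R →
      ‖z * F z / B z‖ ≤ Real.exp (ε * R ^ 3 / z.im ^ 2) := by
  obtain ⟨g₁, g₂, hg₁, hg₂, ⟨C₁, hC₁⟩, ⟨C₂, hC₂⟩, hg0, hFB⟩ := hq
  obtain ⟨z₁, hz₁, hgz₁⟩ : ∃ z ∈ UpperHalf, g₂ z ≠ 0 := by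
    by_contra! h; exact hg0 h
  set C := max 1 (max C₁ C₂) with hC
  have hCpos : 0 < C := one_pos.trans_le (le_max_left _ _)
  have hsq : ∀ z ∈ UpperHalf, 1 ≤ ‖z + Complex.I‖ ∧ ‖z‖ ≤ ‖z + Complex.I‖ := by
    intro z hz
    have hz : 0 < z.im := hz
    constructor
    · refine le_trans ?_ ((le_abs_self _).trans (Complex.abs_im_le_norm (z + Complex.I)))
      simp [hz.le]
    · rw [← sq_le_sq₀ (norm_nonneg _) (norm_nonneg _), ← Complex.normSq_eq_norm_sq,
        ← Complex.normSq_eq_norm_sq, Complex.normSq_apply, Complex.normSq_apply]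
      simp only [Complex.add_re, Complex.add_im, Complex.I_re, Complex.I_im]
      nlinarith
  have hpos : ∀ z ∈ UpperHalf, 0 < ‖z + Complex.I‖ := fun z hz => one_pos.trans_le (hsq z hz).1
  have hne : ∀ z ∈ UpperHalf, (C : ℂ) * (z + Complex.I) ≠ 0 := fun z hz =>
    mul_ne_zero (by exact_mod_cast hCpos.ne') (norm_pos_iff.1 (hpos z hz))
  have hnorm : ∀ z : ℂ, ‖(C : ℂ) * (z + Complex.I)‖ = C * ‖z + Complex.I‖ := by
    intro z
    rw [norm_mul, Complex.norm_real, Real.norm_of_nonneg hCpos.le]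
  refine norm_le_exp_of_mul_eq_of_bounded_imaginary_axis (f := fun z => z * F z / B z)
    (G := fun z => g₂ z / (C * (z + Complex.I))) (N := fun z => z * g₁ z / (C * (z + Complex.I)))
    (M := M) ?_ ?_ ?_ ?_ ?_ ?_ ⟨z₁, hz₁, div_ne_zero hgz₁ (hne z₁ hz₁)⟩ hM hε
  · exact DifferentiableOn.div (by fun_prop) hB.differentiableOn hB0
  · exact hg₂.div (by fun_prop) hne
  · exact (differentiableOn_id.mul hg₁).div (by fun_prop) hne
  · intro z hz
    rw [norm_div, hnorm, div_le_one (mul_pos hCpos (hpos z hz))]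
    calc ‖g₂ z‖ ≤ C * 1 := by
          rw [mul_one]
          exact (hC₂ z hz).trans ((le_max_right _ _).trans (le_max_right _ _))
      _ ≤ _ := by gcongr; exact (hsq z hz).1
  · intro z hz
    rw [norm_div, hnorm, div_le_one (mul_pos hCpos (hpos z hz)), norm_mul, mul_comm]
    gcongr
    · exact (hC₁ z hz).trans ((le_max_left _ _).trans (le_max_right _ _))
    · exact (hsq z hz).2
  · intro z hz
    have h1 := hB0 z hz
    have h2 := hne z hz
    rw [div_mul_div_comm, div_eq_div_iff (mul_ne_zero h1 h2) h2]
    linear_combination (z * ((C : ℂ) * (z + Complex.I))) * hFB z hz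

theorem re_inv_sq (z : ℂ) :
    ((z ^ 2)⁻¹).re = (z.re ^ 2 - z.im ^ 2) / (z.re ^ 2 + z.im ^ 2) ^ 2 := by
  rw [Complex.inv_re, map_pow, Complex.normSq_apply]
  congr 1
  · simp [pow_two, Complex.mul_re]
  · ring

theorem re_inv_sq_nonneg {z : ℂ} (hz : |z.im| ≤ z.re) : 0 ≤ ((z ^ 2)⁻¹).re := by
  rw [re_inv_sq]
  have : z.im ^ 2 ≤ z.re ^ 2 := sq_le_sq.2 (hz.trans (le_abs_self _))
  exact div_nonneg (by linarith) (by positivity)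

/-- An entire function bounded by `2 * exp (K / y ^ 2)` off the real axis on a disc of radius `R`
is bounded by `2 * exp (32 * K / R ^ 2)` on a concentric smaller disc. -/
theorem norm_le_two_mul_exp_of_bound_off_real {h : ℂ → ℂ} (hh : Differentiable ℂ h) {K R : ℝ}
    (hK : 0 < K) (hR : 0 < R)
    (hb : ∀ z : ℂ, ‖z‖ ≤ R → z.im ≠ 0 → ‖h z‖ ≤ 2 * Real.exp (K / z.im ^ 2))
    {z : ℂ} (hz : ‖z‖ ≤ R / 4) : ‖h z‖ ≤ 2 * Real.exp (32 * K / R ^ 2) := by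
  obtain ⟨S, hS⟩ := (isCompact_closedBall (0 : ℂ) R).exists_bound_of_continuousOn
    hh.continuous.continuousOn
  have hS : ∀ z : ℂ, ‖z‖ ≤ R → ‖h z‖ ≤ S := fun z hz => hS z (by simpa using hz)
  obtain ⟨δ, hδ0, hδR, hδS⟩ : ∃ δ : ℝ, 0 < δ ∧ δ < R / 2 ∧ S * δ ^ 2 ≤ 4 * K := by
    have h1 : Tendsto (fun δ : ℝ => S * δ ^ 2) (𝓝[>] 0) (𝓝 0) := by
      have : Continuous fun δ : ℝ => S * δ ^ 2 := by fun_prop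
      simpa using (this.tendsto 0).mono_left nhdsWithin_le_nhds
    obtain ⟨δ, h2, h3⟩ := ((h1.eventually (ge_mem_nhds (show (0 : ℝ) < 4 * K by positivity))).and
      (Ioo_mem_nhdsGT (show (0 : ℝ) < R / 2 by positivity))).exists
    exact ⟨δ, h3.1, h3.2, h2⟩
  set E : ℂ → ℂ := fun ζ =>
    Complex.exp (-((9 * K : ℝ) * (((ζ + R) ^ 2)⁻¹ + ((R - ζ) ^ 2)⁻¹))) with hE
  have hEn : ∀ ζ, ‖E ζ‖ =
      Real.exp (-(9 * K * ((((ζ + R) ^ 2)⁻¹).re + (((R - ζ) ^ 2)⁻¹).re))) := by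
    intro ζ
    rw [hE, Complex.norm_exp, Complex.neg_re, Complex.re_ofReal_mul, Complex.add_re]
  set U : Set ℂ := {ζ | |ζ.re| < R - δ} ∩ {ζ | |ζ.im| < (R - |ζ.re|) / 2} with hU
  have hcre := Complex.continuous_re
  have hcim := Complex.continuous_im
  have hUo : IsOpen U :=
    (isOpen_lt (by fun_prop) continuous_const).inter (isOpen_lt (by fun_prop) (by fun_prop))
  have hcl : ∀ ζ ∈ closure U, |ζ.re| ≤ R - δ ∧ |ζ.im| ≤ (R - |ζ.re|) / 2 := by
    have h1 : IsClosed {ζ : ℂ | |ζ.re| ≤ R - δ ∧ |ζ.im| ≤ (R - |ζ.re|) / 2} :=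
      (isClosed_le hcre.abs continuous_const).inter
        (isClosed_le hcim.abs ((continuous_const.sub hcre.abs).div_const 2))
    have h2 : U ⊆ {ζ : ℂ | |ζ.re| ≤ R - δ ∧ |ζ.im| ≤ (R - |ζ.re|) / 2} := by
      rintro ζ ⟨h1, h2⟩
      exact ⟨le_of_lt (show |ζ.re| < R - δ from h1),
        le_of_lt (show |ζ.im| < (R - |ζ.re|) / 2 from h2)⟩
    exact fun ζ hζ => closure_minimal h2 h1 hζ
  have hsum : ∀ ζ : ℂ, |ζ.re| ≤ R - δ → |ζ.im| ≤ (R - |ζ.re|) / 2 → ‖ζ‖ ≤ R := by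
    intro ζ h1 h2
    have := Complex.norm_le_abs_re_add_abs_im ζ
    linarith
  have hbdd : Bornology.IsBounded U := by
    refine (Metric.isBounded_closedBall (x := (0 : ℂ)) (r := R)).subset fun ζ hζ => ?_
    obtain ⟨h1, h2⟩ := hcl ζ (subset_closure hζ)
    simpa using hsum ζ h1 h2
  have hd : DiffContOnCl ℂ (fun ζ => h ζ * E ζ) U := by
    refine DifferentiableOn.diffContOnCl ?_
    refine hh.differentiableOn.mul (DifferentiableOn.cexp ?_)
    have hne1 : ∀ ζ ∈ closure U, (ζ + R) ^ 2 ≠ 0 := by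
      intro ζ hζ h0
      have := congrArg Complex.re (pow_eq_zero_iff two_ne_zero |>.1 h0)
      simp at this
      have h1 := (hcl ζ hζ).1
      have := neg_abs_le ζ.re
      linarith
    have hne2 : ∀ ζ ∈ closure U, (R - ζ) ^ 2 ≠ 0 := by
      intro ζ hζ h0
      have := congrArg Complex.re (pow_eq_zero_iff two_ne_zero |>.1 h0)
      simp at this
      have h1 := (hcl ζ hζ).1
      have := le_abs_self ζ.re
      linarith
    refine (DifferentiableOn.const_mul ?_ _).neg
    exact (DifferentiableOn.inv (by fun_prop) hne1).add (DifferentiableOn.inv (by fun_prop) hne2)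
  have hzre := Complex.abs_re_le_norm z
  have hzim := Complex.abs_im_le_norm z
  have hzU : z ∈ closure U := by
    refine subset_closure ⟨?_, ?_⟩
    · change |z.re| < R - δ
      linarith
    · change |z.im| < (R - |z.re|) / 2
      linarith
  have hmain : ‖h z * E z‖ ≤ 2 := by
    refine Complex.norm_le_of_forall_mem_frontier_norm_le hbdd hd (fun ζ hζ => ?_) hzU
    rw [frontier, hUo.interior_eq] at hζ
    obtain ⟨h1, h2⟩ := hcl ζ hζ.1
    have hζR := hsum ζ h1 h2
    have hp1 : 0 ≤ (((ζ + R) ^ 2)⁻¹).re := by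
      refine re_inv_sq_nonneg ?_
      simp only [Complex.add_re, Complex.add_im, Complex.ofReal_re, Complex.ofReal_im, add_zero]
      have := neg_abs_le ζ.re
      linarith
    have hp2 : 0 ≤ (((R - ζ) ^ 2)⁻¹).re := by
      refine re_inv_sq_nonneg ?_
      simp only [Complex.sub_re, Complex.sub_im, Complex.ofReal_re, Complex.ofReal_im, zero_sub,
        abs_neg]
      have := le_abs_self ζ.re
      linarith
    set T := (((ζ + R) ^ 2)⁻¹).re + (((R - ζ) ^ 2)⁻¹).re with hT
    have hmax : ((R - |ζ.re|) ^ 2 - ζ.im ^ 2) / ((R - |ζ.re|) ^ 2 + ζ.im ^ 2) ^ 2 ≤ T := by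
      rcases le_total 0 ζ.re with h3 | h3
      · rw [abs_of_nonneg h3]
        have : (((R - ζ) ^ 2)⁻¹).re =
            ((R - ζ.re) ^ 2 - ζ.im ^ 2) / ((R - ζ.re) ^ 2 + ζ.im ^ 2) ^ 2 := by
          rw [re_inv_sq]; simp
        linarith
      · rw [abs_of_nonpos h3]
        have : (((ζ + R) ^ 2)⁻¹).re =
            ((R - -ζ.re) ^ 2 - ζ.im ^ 2) / ((R - -ζ.re) ^ 2 + ζ.im ^ 2) ^ 2 := by
          rw [re_inv_sq]; simp [add_comm]
        linarith
    set u := R - |ζ.re| with hu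
    have hu0 : 0 < u := by linarith
    have hnn : ‖h ζ * E ζ‖ = ‖h ζ‖ * Real.exp (-(9 * K * T)) := by rw [norm_mul, hEn]
    rw [hnn]
    rcases h2.eq_or_lt with h3 | h3
    · have hy0 : ζ.im ≠ 0 := by
        intro h0
        rw [h0, abs_zero] at h3
        linarith
      have hu2 : u ^ 2 = 4 * ζ.im ^ 2 := by
        rw [← sq_abs ζ.im, h3]; ring
      have h4 : K / ζ.im ^ 2 ≤ 9 * K * T := by
        have h5 : (u ^ 2 - ζ.im ^ 2) / (u ^ 2 + ζ.im ^ 2) ^ 2 = 3 / 25 * (1 / ζ.im ^ 2) := by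
          rw [hu2]; field_simp; ring
        rw [h5] at hmax
        have h6 : 0 < 1 / ζ.im ^ 2 := by positivity
        calc K / ζ.im ^ 2 = K * (1 / ζ.im ^ 2) := by ring
          _ ≤ K * (9 * T) := by
              gcongr
              linarith
          _ = _ := by ring
      calc _ ≤ 2 * Real.exp (K / ζ.im ^ 2) * Real.exp (-(K / ζ.im ^ 2)) := by
            gcongr
            exact hb ζ hζR hy0
        _ = 2 := by rw [mul_assoc, ← Real.exp_add]; simp
    · have h4 : u = δ := by
        refine le_antisymm ?_ (by linarith)
        by_contra! h5
        exact hζ.2 ⟨show |ζ.re| < R - δ by linarith, h3⟩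
      have h5 : ζ.im ^ 2 ≤ δ ^ 2 / 4 := by
        rw [← sq_abs, ← h4, show u ^ 2 / 4 = (u / 2) ^ 2 by ring]
        gcongr
      have h6 : S ≤ 9 * K * T := by
        have h7 : 12 / 25 / δ ^ 2 ≤ T := by
          refine le_trans ?_ hmax
          rw [h4]
          calc 12 / 25 / δ ^ 2 = (δ ^ 2 - δ ^ 2 / 4) / (δ ^ 2 + δ ^ 2 / 4) ^ 2 := by
                field_simp; norm_num
            _ ≤ _ := by
              have : 0 ≤ ζ.im ^ 2 := sq_nonneg _
              gcongr
              nlinarith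
        calc S ≤ 4 * K / δ ^ 2 := by rwa [le_div_iff₀ (by positivity)]
          _ ≤ 9 * K * (12 / 25 / δ ^ 2) := by
              rw [show 9 * K * (12 / 25 / δ ^ 2) = (108 / 25 * K) / δ ^ 2 by ring]
              gcongr
              linarith
          _ ≤ _ := by gcongr
      have h7 : ‖h ζ‖ ≤ Real.exp (9 * K * T) :=
        (hS ζ hζR).trans (h6.trans ((Real.add_one_le_exp _).trans' (by linarith)))
      calc _ ≤ Real.exp (9 * K * T) * Real.exp (-(9 * K * T)) := by gcongr
        _ = 1 := by rw [← Real.exp_add]; simp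
        _ ≤ 2 := one_le_two
  have hlow : Real.exp (-(32 * K / R ^ 2)) ≤ ‖E z‖ := by
    rw [hEn]
    refine Real.exp_le_exp.2 (neg_le_neg ?_)
    have hw : ∀ w : ℂ, 3 / 4 * R ≤ ‖w‖ → ((w ^ 2)⁻¹).re ≤ 16 / 9 / R ^ 2 := by
      intro w hw
      refine ((le_abs_self _).trans (Complex.abs_re_le_norm _)).trans ?_
      rw [norm_inv, norm_pow]
      calc (‖w‖ ^ 2)⁻¹ ≤ ((3 / 4 * R) ^ 2)⁻¹ := by gcongr
        _ = _ := by field_simp; norm_num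
    have hRn : ‖(R : ℂ)‖ = R := by rw [Complex.norm_real, Real.norm_of_nonneg hR.le]
    have h1 := hw (z + R) (by
      have := norm_sub_norm_le (R : ℂ) (-z)
      rw [norm_neg, sub_neg_eq_add, add_comm (R : ℂ)] at this
      linarith)
    have h2 := hw (R - z) (by
      have := norm_sub_norm_le (R : ℂ) z
      linarith)
    calc _ ≤ 9 * K * (16 / 9 / R ^ 2 + 16 / 9 / R ^ 2) := by gcongr
      _ = _ := by ring
  have hfin : ‖h z‖ * Real.exp (-(32 * K / R ^ 2)) ≤ 2 := by
    refine le_trans ?_ hmain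
    rw [norm_mul]
    gcongr
  rwa [Real.exp_neg, ← div_eq_mul_inv, div_le_iff₀ (Real.exp_pos _)] at hfin

theorem norm_le_of_subexponential_of_imaginary_axis {h : ℂ → ℂ} (hh : Differentiable ℂ h)
    (hexp : ∀ ε : ℝ, 0 < ε → ∃ R₀ : ℝ, ∀ z : ℂ, R₀ ≤ ‖z‖ → ‖h z‖ ≤ 2 * Real.exp (ε * ‖z‖))
    {M : ℝ} (hM : ∀ y : ℝ, ‖h (y * Complex.I)‖ ≤ M) {z : ℂ} (hz : 0 ≤ z.re) : ‖h z‖ ≤ M := by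
  have hstep : ∀ ε : ℝ, 0 < ε → ‖h z‖ ≤ M * Real.exp (ε * z.re) := by
    intro ε hε
    set g : ℂ → ℂ := fun ζ => h ζ * Complex.exp (-(ε * ζ)) with hg
    have hgn : ∀ ζ, ‖g ζ‖ = ‖h ζ‖ * Real.exp (-(ε * ζ.re)) := by
      intro ζ
      rw [hg, norm_mul, Complex.norm_exp, Complex.neg_re, Complex.re_ofReal_mul]
    obtain ⟨R₀, hR₀⟩ := hexp ε hε
    have hgd : Differentiable ℂ g := hh.mul (by fun_prop)
    have := PhragmenLindelof.right_half_plane_of_bounded_on_real (f := g) (C := M) (z := z)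
      hgd.diffContOnCl ⟨1, one_lt_two, ε, ?_⟩ ?_ ?_ hz
    · rwa [hgn, Real.exp_neg, ← div_eq_mul_inv, div_le_iff₀ (Real.exp_pos _)] at this
    · refine Asymptotics.IsBigO.of_bound 2 ?_
      rw [eventually_inf_principal]
      filter_upwards [(tendsto_norm_cobounded_atTop (E := ℂ)).eventually_ge_atTop R₀] with ζ hζ hre
      have hre : 0 < ζ.re := hre
      rw [Real.norm_of_nonneg (Real.exp_pos _).le, Real.rpow_one, hgn]
      refine (mul_le_of_le_one_right (norm_nonneg _) ?_).trans (hR₀ ζ hζ)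
      rw [Real.exp_le_one_iff]
      have := mul_pos hε hre
      linarith
    · refine ⟨2, ?_⟩
      rw [eventually_map]
      filter_upwards [eventually_ge_atTop R₀, eventually_ge_atTop 0] with x hx hx0
      have hn : ‖(x : ℂ)‖ = x := by rw [Complex.norm_real, Real.norm_of_nonneg hx0]
      rw [hgn]
      calc _ ≤ 2 * Real.exp (ε * x) * Real.exp (-(ε * x)) := by
            rw [Complex.ofReal_re]
            gcongr
            have := hR₀ x (by rwa [hn])
            rwa [hn] at this
        _ = 2 := by rw [mul_assoc, ← Real.exp_add]; simp
    · intro x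
      rw [hgn]
      simpa using hM x
  have hlim : Tendsto (fun ε : ℝ => M * Real.exp (ε * z.re)) (𝓝[>] 0) (𝓝 M) := by
    have : Continuous fun ε : ℝ => M * Real.exp (ε * z.re) := by fun_prop
    simpa using (this.tendsto 0).mono_left nhdsWithin_le_nhds
  refine ge_of_tendsto hlim ?_
  filter_upwards [self_mem_nhdsWithin] with ε hε using hstep ε hε

/-- An entire function of order one and minimal type which tends to zero along the imaginary axis
vanishes identically. -/
theorem eq_zero_of_subexponential_of_tendsto_zero {h : ℂ → ℂ} (hh : Differentiable ℂ h)
    (hexp : ∀ ε : ℝ, 0 < ε → ∃ R₀ : ℝ, ∀ z : ℂ, R₀ ≤ ‖z‖ → ‖h z‖ ≤ 2 * Real.exp (ε * ‖z‖))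
    (hlim : Tendsto (fun y : ℝ => h (y * Complex.I)) (cocompact ℝ) (𝓝 0)) (z : ℂ) : h z = 0 := by
  have hc : Continuous fun y : ℝ => h (y * Complex.I) := hh.continuous.comp (by fun_prop)
  obtain ⟨M, hM⟩ : ∃ M, ∀ y : ℝ, ‖h (y * Complex.I)‖ ≤ M := by
    obtain ⟨K, hK, hKc⟩ := mem_cocompact.1
      ((hlim.norm.eventually (ge_mem_nhds (show ‖(0 : ℂ)‖ < 1 by simp))))
    obtain ⟨C, hC⟩ := hK.exists_bound_of_continuousOn hc.continuousOn
    refine ⟨max C 1, fun y => ?_⟩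
    by_cases hy : y ∈ K
    · exact (hC y hy).trans (le_max_left _ _)
    · exact (hKc hy : ‖h (y * Complex.I)‖ ≤ 1).trans (le_max_right _ _)
  have hbd : ∀ z, ‖h z‖ ≤ M := by
    intro z
    rcases le_total 0 z.re with h1 | h1
    · exact norm_le_of_subexponential_of_imaginary_axis hh hexp hM h1
    · have := norm_le_of_subexponential_of_imaginary_axis (h := fun z => h (-z))
        (hh.comp differentiable_neg) (fun ε hε => ?_) (M := M) (fun y => ?_) (z := -z)
        (by simpa using h1)
      · simpa using this
      · obtain ⟨R₀, hR₀⟩ := hexp ε hε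
        exact ⟨R₀, fun z hz => by simpa using hR₀ (-z) (by simpa using hz)⟩
      · simpa using hM (-y)
  have hconst : ∀ w, h w = h z := fun w => hh.apply_eq_apply_of_bounded
    (isBounded_iff_forall_norm_le.2 ⟨M, by rintro _ ⟨w, rfl⟩; exact hbd w⟩) w z
  simp_rw [hconst] at hlim
  exact tendsto_nhds_unique tendsto_const_nhds hlim

/-- An entire function vanishing at the (simple) zeros of `B` is divisible by `B`. -/
theorem exists_differentiable_mul_eq {H B : ℂ → ℂ} (hH : Differentiable ℂ H)
    (hB : Differentiable ℂ B) (hsimple : ∀ z, B z = 0 → deriv B z ≠ 0)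
    (hzero : ∀ z, B z = 0 → H z = 0) :
    ∃ h : ℂ → ℂ, Differentiable ℂ h ∧ ∀ z, B z * h z = H z := by
  classical
  have hds : ∀ {f : ℂ → ℂ}, Differentiable ℂ f → ∀ x, Differentiable ℂ (dslope f x) := by
    intro f hf x
    rw [← differentiableOn_univ, Complex.differentiableOn_dslope univ_mem, differentiableOn_univ]
    exact hf
  refine ⟨fun z => if B z = 0 then deriv H z / deriv B z else H z / B z, fun x => ?_, fun z => ?_⟩
  · by_cases hx : B x = 0
    · have hne : ∀ᶠ z in 𝓝 x, dslope B x z ≠ 0 :=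
        (hds hB x).continuous.continuousAt.eventually_ne (by rw [dslope_same]; exact hsimple x hx)
      have heq : (fun z => if B z = 0 then deriv H z / deriv B z else H z / B z)
          =ᶠ[𝓝 x] fun z => dslope H x z / dslope B x z := by
        filter_upwards [hne] with z hz
        rcases eq_or_ne z x with rfl | hzx
        · simp [hx, dslope_same]
        · rw [dslope_of_ne _ hzx, slope_def_field, hx, sub_zero] at hz
          have hBz : B z ≠ 0 := fun h0 => hz (by simp [h0])
          have hzx' := sub_ne_zero.2 hzx
          rw [if_neg hBz, dslope_of_ne _ hzx, dslope_of_ne _ hzx, slope_def_field, slope_def_field,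
            hx, hzero x hx, sub_zero, sub_zero, div_div_div_cancel_right₀ hzx']
      refine DifferentiableAt.congr_of_eventuallyEq ?_ heq
      exact (hds hH x x).div (hds hB x x) hne.self_of_nhds
    · have heq : (fun z => if B z = 0 then deriv H z / deriv B z else H z / B z)
          =ᶠ[𝓝 x] fun z => H z / B z := by
        filter_upwards [hB.continuous.continuousAt.eventually_ne hx] with z hz
        rw [if_neg hz]
      exact DifferentiableAt.congr_of_eventuallyEq ((hH x).div (hB x) hx) heq
  · by_cases hz : B z = 0
    · simp [hz, hzero z hz]
    · simp only [if_neg hz]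
      exact mul_div_cancel₀ _ hz

theorem exists_norm_dslope_le {B : ℂ → ℂ} (hB : Differentiable ℂ B) {K : Set ℂ}
    (hK : Bornology.IsBounded K) :
    ∃ A : ℝ, ∀ z ∈ K, ∀ x, B x = 0 → ‖dslope B x z‖ ≤ A := by
  obtain ⟨r, hr⟩ := hK.subset_closedBall 0
  obtain ⟨A₁, hA₁⟩ := (isCompact_closedBall (0 : ℂ) r).exists_bound_of_continuousOn
    hB.continuous.continuousOn
  obtain ⟨A₂, hA₂⟩ := (isCompact_closedBall (0 : ℂ) (r + 1)).exists_bound_of_continuousOn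
    hB.deriv.continuous.continuousOn
  refine ⟨max A₁ A₂, fun z hz x hx => ?_⟩
  have hzr : ‖z‖ ≤ r := by simpa using hr hz
  have hzmem : z ∈ Metric.closedBall (0 : ℂ) (r + 1) := by
    simp only [mem_closedBall_zero_iff]; linarith
  rcases eq_or_ne z x with rfl | hzx
  · rw [dslope_same]
    exact (hA₂ z hzmem).trans (le_max_right _ _)
  · have hpos : 0 < ‖z - x‖ := norm_pos_iff.2 (sub_ne_zero.2 hzx)
    rw [dslope_of_ne _ hzx, slope_def_field, norm_div, div_le_iff₀ hpos]
    rcases le_or_gt 1 ‖z - x‖ with h1 | h1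
    · have h2 := hA₁ z (by simpa using hzr)
      have h3 : 0 ≤ max A₁ A₂ := (norm_nonneg _).trans (h2.trans (le_max_left _ _))
      rw [hx, sub_zero]
      exact (h2.trans (le_max_left _ _)).trans (le_mul_of_one_le_right h3 h1)
    · have hxmem : x ∈ Metric.closedBall (0 : ℂ) (r + 1) := by
        rw [mem_closedBall_zero_iff]
        have := norm_sub_norm_le x z
        rw [norm_sub_rev] at this
        linarith
      refine (Convex.norm_image_sub_le_of_norm_deriv_le (fun w _ => hB w) hA₂
        (convex_closedBall _ _) hxmem hzmem).trans ?_
      gcongr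
      exact le_max_right _ _

theorem finite_real_zeros_inter_of_isCompact {B : ℂ → ℂ} (hB : Differentiable ℂ B)
    (hsimple : ∀ z, B z = 0 → deriv B z ≠ 0) {K : Set ℝ} (hK : IsCompact K) :
    ({t : ℝ | B t = 0} ∩ K).Finite := by
  by_contra hinf
  obtain ⟨x, -, hx⟩ := Set.Infinite.exists_accPt_of_subset_isCompact hinf hK Set.inter_subset_right
  rw [accPt_iff_frequently_nhdsNE] at hx
  have hc : Continuous fun t : ℝ => B t := hB.continuous.comp Complex.continuous_ofReal
  have hx0 : B x = 0 := by
    have h1 : ∃ᶠ t : ℝ in 𝓝 x, B t = 0 :=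
      (hx.filter_mono nhdsWithin_le_nhds).mono fun t ht => ht.1
    by_contra h0
    exact h1 (hc.continuousAt.eventually_ne h0)
  have hd : HasDerivAt (fun t : ℝ => B t) (deriv B x) x := (hB x).hasDerivAt.comp_ofReal
  exact hx ((hd.eventually_ne (c := 0) (hsimple x hx0)).mono fun t ht h => ht h.1)

theorem summable_norm_of_tsum_weight_ne_top {F B : ℂ → ℂ} {W : ℝ → ℝ≥0∞}
    (hB : Differentiable ℂ B) (hsimple : ∀ z, B z = 0 → deriv B z ≠ 0) (hW : ∀ x, 0 < W x)
    (hFW : MemC0e W (fun x : ℝ => F (x : ℂ)))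
    (hsum : (∑' x : {t : ℝ // B (t : ℂ) = 0},
        ENNReal.ofReal |x.1| * W x.1 / (‖deriv B (x.1 : ℂ)‖₊ : ℝ≥0∞)) ≠ ⊤) :
    Summable fun x : {t : ℝ // B (t : ℂ) = 0} =>
      ‖(x.1 : ℂ) * F (x.1 : ℂ) / deriv B (x.1 : ℂ)‖ := by
  refine Summable.of_norm_bounded_eventually (ENNReal.summable_toReal hsum) ?_
  obtain ⟨K, hK, hKc⟩ := mem_cocompact.1 (hFW.2.eventually (ge_mem_nhds one_pos))
  have hfin : {x : {t : ℝ // B (t : ℂ) = 0} | x.1 ∈ K}.Finite := by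
    refine ((finite_real_zeros_inter_of_isCompact hB hsimple hK).preimage
      Subtype.val_injective.injOn).subset fun x hx => ⟨x.2, hx⟩
  rw [eventually_cofinite]
  refine hfin.subset fun x hx => ?_
  by_contra hxK
  refine hx ?_
  have h1 : (‖F (x.1 : ℂ)‖₊ : ℝ≥0∞) / W x.1 ≤ 1 := hKc hxK
  rw [ENNReal.div_le_iff_le_mul (Or.inl (hW x.1).ne') (Or.inr one_ne_zero), one_mul] at h1
  have h2 : ENNReal.ofReal ‖(x.1 : ℂ) * F (x.1 : ℂ) / deriv B (x.1 : ℂ)‖ ≤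
      ENNReal.ofReal |x.1| * W x.1 / (‖deriv B (x.1 : ℂ)‖₊ : ℝ≥0∞) := by
    rw [norm_div, norm_mul, ENNReal.ofReal_div_of_pos (norm_pos_iff.2 (hsimple _ x.2)),
      ENNReal.ofReal_mul (norm_nonneg _), Complex.norm_real, Real.norm_eq_abs,
      ofReal_norm, ofReal_norm]
    exact ENNReal.div_le_div_right (mul_le_mul_right h1 _) _
  rw [norm_norm, ← ENNReal.toReal_ofReal (norm_nonneg _)]
  exact ENNReal.toReal_mono (ENNReal.ne_top_of_tsum_ne_top hsum x) h2

section LagrangeSeries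

variable {B : ℂ → ℂ} {c : {t : ℝ // B (t : ℂ) = 0} → ℂ}

theorem exists_summable_bound_lagrange (hB : Differentiable ℂ B) (hc : Summable fun x => ‖c x‖)
    {K : Set ℂ} (hK : Bornology.IsBounded K) :
    ∃ u : {t : ℝ // B (t : ℂ) = 0} → ℝ, Summable u ∧
      ∀ x, ∀ z ∈ K, ‖c x * dslope B (x.1 : ℂ) z‖ ≤ u x := by
  obtain ⟨A, hA⟩ := exists_norm_dslope_le hB hK
  refine ⟨fun x => ‖c x‖ * A, hc.mul_right A, fun x z hz => ?_⟩
  rw [norm_mul]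
  exact mul_le_mul_of_nonneg_left (hA z hz _ x.2) (norm_nonneg _)

theorem tendstoUniformlyOn_lagrange (hB : Differentiable ℂ B) (hc : Summable fun x => ‖c x‖)
    {K : Set ℂ} (hK : IsCompact K) :
    TendstoUniformlyOn
      (fun (s : Finset {t : ℝ // B (t : ℂ) = 0}) (z : ℂ) =>
        ∑ x ∈ s, c x * dslope B (x.1 : ℂ) z)
      (fun z => ∑' x, c x * dslope B (x.1 : ℂ) z) atTop K := by
  obtain ⟨u, hu, hle⟩ := exists_summable_bound_lagrange hB hc hK.isBounded
  exact tendstoUniformlyOn_tsum hu hle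

theorem summable_lagrange (hB : Differentiable ℂ B) (hc : Summable fun x => ‖c x‖) (z : ℂ) :
    Summable fun x => c x * dslope B (x.1 : ℂ) z := by
  obtain ⟨u, hu, hle⟩ := exists_summable_bound_lagrange hB hc
    (Bornology.isBounded_singleton (x := z))
  exact Summable.of_norm_bounded hu fun x => hle x z rfl

theorem differentiable_lagrange (hB : Differentiable ℂ B) (hc : Summable fun x => ‖c x‖) :
    Differentiable ℂ fun z => ∑' x, c x * dslope B (x.1 : ℂ) z := by
  intro z
  obtain ⟨u, hu, hle⟩ := exists_summable_bound_lagrange hB hc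
    (Metric.isBounded_ball (x := z) (r := 1))
  refine (Complex.differentiableOn_tsum_of_summable_norm hu (fun x => ?_) Metric.isOpen_ball
    hle).differentiableAt (Metric.ball_mem_nhds z one_pos)
  have : DifferentiableOn ℂ (dslope B (x.1 : ℂ)) Set.univ :=
    (Complex.differentiableOn_dslope univ_mem).2 hB.differentiableOn
  exact (this.mono (Set.subset_univ _)).const_mul _

theorem lagrange_apply_zero (x₀ : {t : ℝ // B (t : ℂ) = 0}) :
    ∑' x, c x * dslope B (x.1 : ℂ) (x₀.1 : ℂ) = c x₀ * deriv B (x₀.1 : ℂ) := by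
  rw [tsum_eq_single x₀, dslope_same]
  intro x hx
  have hne : (x₀.1 : ℂ) ≠ x.1 := fun h => hx (Subtype.ext (Complex.ofReal_injective h).symm)
  rw [dslope_of_ne _ hne, slope_def_field, x.2, x₀.2]
  simp

theorem norm_lagrange_div_le (hc : Summable fun x => ‖c x‖) {z : ℂ} (hz : z.im ≠ 0) :
    ‖(∑' x, c x * dslope B (x.1 : ℂ) z) / B z‖ ≤ (∑' x, ‖c x‖) / |z.im| := by
  have hzpos : 0 < |z.im| := abs_pos.2 hz
  rcases eq_or_ne (B z) 0 with hBz | hBz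
  · rw [hBz, div_zero, norm_zero]
    exact div_nonneg (tsum_nonneg fun _ => norm_nonneg _) hzpos.le
  · have hterm : ∀ x : {t : ℝ // B (t : ℂ) = 0},
        ‖c x * dslope B (x.1 : ℂ) z / B z‖ ≤ ‖c x‖ / |z.im| := by
      intro x
      have hne : z ≠ x.1 := fun h => hz (by rw [h]; simp)
      have him : |z.im| ≤ ‖z - x.1‖ := by
        simpa using Complex.abs_im_le_norm (z - (x.1 : ℂ))
      rw [dslope_of_ne _ hne, slope_def_field, x.2, sub_zero, mul_div_assoc, div_right_comm,
        div_self hBz, norm_mul, norm_div, norm_one, mul_one_div]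
      gcongr
    rw [← tsum_div_const, ← tsum_div_const]
    exact tsum_of_norm_bounded (hc.div_const _).hasSum hterm

end LagrangeSeries

open ComplexConjugate in
/-- The product `z * F z` is the sum of its Lagrange series. -/
theorem mul_eq_lagrange {F B : ℂ → ℂ} (hF : Differentiable ℂ F) (hB : Differentiable ℂ B)
    (hreal : ∀ z : ℂ, B z = 0 → z.im = 0) (hsimple : ∀ z, B z = 0 → deriv B z ≠ 0)
    (hsymm : ∀ z : ℂ, B z = conj (B (conj z))) (hq : BddTypeQuot UpperHalf F B)
    (hq' : BddTypeQuot UpperHalf (fun z => conj (F (conj z))) B)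
    (hdecay : (fun y : ℝ => (y : ℂ) * F ((y : ℂ) * Complex.I)) =o[atTop ⊔ atBot]
      (fun y : ℝ => B ((y : ℂ) * Complex.I)))
    (hc : Summable fun x : {t : ℝ // B (t : ℂ) = 0} =>
      ‖(x.1 : ℂ) * F (x.1 : ℂ) / deriv B (x.1 : ℂ)‖) (z : ℂ) :
    z * F z = ∑' x : {t : ℝ // B (t : ℂ) = 0},
      (x.1 : ℂ) * F (x.1 : ℂ) / deriv B (x.1 : ℂ) * dslope B (x.1 : ℂ) z := by
  set T : ℂ → ℂ := fun z => ∑' x : {t : ℝ // B (t : ℂ) = 0},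
      (x.1 : ℂ) * F (x.1 : ℂ) / deriv B (x.1 : ℂ) * dslope B (x.1 : ℂ) z with hT
  set C := ∑' x : {t : ℝ // B (t : ℂ) = 0},
      ‖(x.1 : ℂ) * F (x.1 : ℂ) / deriv B (x.1 : ℂ)‖ with hC
  have hC0 : 0 ≤ C := tsum_nonneg fun _ => norm_nonneg _
  have hTd : Differentiable ℂ T := differentiable_lagrange hB hc
  have hTB : ∀ z : ℂ, z.im ≠ 0 → ‖T z / B z‖ ≤ C / |z.im| := fun z hz =>
    norm_lagrange_div_le hc hz
  have hBne : ∀ z : ℂ, z.im ≠ 0 → B z ≠ 0 := fun z hz h0 => hz (hreal z h0)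
  have hzero : ∀ z, B z = 0 → z * F z - T z = 0 := by
    intro z hz
    have hzr : ((z.re : ℝ) : ℂ) = z := Complex.ext rfl (by simp [hreal z hz])
    have := lagrange_apply_zero (B := B)
      (c := fun x => (x.1 : ℂ) * F (x.1 : ℂ) / deriv B (x.1 : ℂ)) ⟨z.re, by rwa [hzr]⟩
    simp only [hzr] at this
    rw [div_mul_cancel₀ _ (hsimple z hz)] at this
    rw [hT, sub_eq_zero]
    exact this.symm
  obtain ⟨h, hhd, hBh⟩ := exists_differentiable_mul_eq ((differentiable_id.mul hF).sub hTd) hB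
    hsimple hzero
  have hBh : ∀ z, B z * h z = z * F z - T z := hBh
  have hheq : ∀ z : ℂ, z.im ≠ 0 → h z = z * F z / B z - T z / B z := by
    intro z hz
    rw [← sub_div, ← hBh, mul_div_cancel_left₀ _ (hBne z hz)]
  have hquot : Tendsto (fun y : ℝ => (y : ℂ) * F ((y : ℂ) * Complex.I) / B ((y : ℂ) * Complex.I))
      (cocompact ℝ) (𝓝 0) := by
    rw [cocompact_eq_atBot_atTop, sup_comm]
    exact hdecay.tendsto_div_nhds_zero
  have hquotI : ∀ y : ℝ, ‖(y * Complex.I) * F (y * Complex.I) / B (y * Complex.I)‖ =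
      ‖(y : ℂ) * F ((y : ℂ) * Complex.I) / B ((y : ℂ) * Complex.I)‖ := by
    intro y
    simp only [norm_div, norm_mul, Complex.norm_I, mul_one]
  have hev : ∀ᶠ y : ℝ in cocompact ℝ,
      ‖(y * Complex.I) * F (y * Complex.I) / B (y * Complex.I)‖ ≤ 1 := by
    filter_upwards [hquot.norm.eventually (ge_mem_nhds (show ‖(0 : ℂ)‖ < 1 by simp))] with y hy
    rw [hquotI]
    exact hy
  rw [cocompact_eq_atBot_atTop, eventually_sup] at hev
  have hconj : ∀ z : ℂ, z * conj (F (conj z)) / B z = conj (conj z * F (conj z) / B (conj z)) := by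
    intro z
    rw [map_div₀, map_mul, Complex.conj_conj, ← hsymm]
  have hevconj : ∀ᶠ y : ℝ in atTop,
      ‖(y * Complex.I) * conj (F (conj (y * Complex.I))) / B (y * Complex.I)‖ ≤ 1 := by
    filter_upwards [tendsto_neg_atTop_atBot.eventually hev.1] with y hy
    rw [hconj, Complex.norm_conj]
    have e : conj ((y : ℂ) * Complex.I) = ((-y : ℝ) : ℂ) * Complex.I := by simp
    rw [e]
    exact hy
  have hFc : Differentiable ℂ fun z => conj (F (conj z)) := fun z => by
    simpa [Function.comp_def] using (hF (conj z)).conj_conj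
  have hUB : ∀ z ∈ UpperHalf, B z ≠ 0 := fun z hz => hBne z (ne_of_gt hz)
  have hexp : ∀ ε : ℝ, 0 < ε → ∃ R₀ : ℝ, ∀ z : ℂ, R₀ ≤ ‖z‖ → ‖h z‖ ≤ 2 * Real.exp (ε * ‖z‖) := by
    intro ε hε
    have hε' : 0 < ε / 128 := by positivity
    obtain ⟨R₁, hR₁⟩ := norm_mul_div_le_exp_of_bddTypeQuot hF hB hUB hq hev.2 hε'
    obtain ⟨R₂, hR₂⟩ := norm_mul_div_le_exp_of_bddTypeQuot hFc hB hUB hq' hevconj hε'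
    have hlarge : ∀ᶠ R : ℝ in atTop, C ≤ ε / 128 * R ^ 2 :=
      ((tendsto_pow_atTop two_ne_zero).const_mul_atTop hε').eventually_ge_atTop C
    obtain ⟨R₃, hR₃⟩ := eventually_atTop.1 hlarge
    refine ⟨max 1 (max R₁ (max R₂ R₃)), fun z hz => ?_⟩
    obtain ⟨hz1, hz'⟩ := max_le_iff.1 hz
    obtain ⟨hz2, hz'⟩ := max_le_iff.1 hz'
    obtain ⟨hz3, hz4⟩ := max_le_iff.1 hz'
    set R := 4 * ‖z‖ with hR
    have hRz : ‖z‖ ≤ R := by linarith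
    have hRpos : 0 < R := by linarith
    have hb : ∀ w : ℂ, ‖w‖ ≤ R → w.im ≠ 0 →
        ‖h w‖ ≤ 2 * Real.exp (ε / 128 * R ^ 3 / w.im ^ 2) := by
      intro w hw hw0
      have hf : ‖w * F w / B w‖ ≤ Real.exp (ε / 128 * R ^ 3 / w.im ^ 2) := by
        rcases hw0.lt_or_gt with h1 | h1
        · have := hR₂ R (hz3.trans hRz) (conj w) (by simpa using h1) (by simpa using hw)
          rwa [hconj, Complex.norm_conj, Complex.conj_conj, Complex.conj_im, neg_sq] at this
        · exact hR₁ R (hz2.trans hRz) w h1 hw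
      have hS : ‖T w / B w‖ ≤ Real.exp (ε / 128 * R ^ 3 / w.im ^ 2) := by
        refine (hTB w hw0).trans ?_
        refine le_trans ?_ ((Real.add_one_le_exp _).trans' (le_add_of_nonneg_right zero_le_one))
        have hpos : 0 < |w.im| := abs_pos.2 hw0
        rw [div_le_div_iff₀ hpos (by positivity)]
        have hwR : |w.im| ≤ R := (Complex.abs_im_le_norm w).trans hw
        have hCR := hR₃ R (hz4.trans hRz)
        calc C * w.im ^ 2 = C * |w.im| * |w.im| := by rw [← sq_abs]; ring
          _ ≤ ε / 128 * R ^ 2 * R * |w.im| := by gcongr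
          _ = _ := by ring
      rw [hheq w hw0]
      refine (norm_sub_le _ _).trans ?_
      linarith
    have := norm_le_two_mul_exp_of_bound_off_real hhd (by positivity) hRpos hb
      (z := z) (by rw [hR]; linarith)
    refine this.trans_eq ?_
    congr 2
    rw [hR]
    have : ‖z‖ ≠ 0 := by linarith
    field_simp
    ring
  have hlim : Tendsto (fun y : ℝ => h (y * Complex.I)) (cocompact ℝ) (𝓝 0) := by
    have h1 : Tendsto (fun y : ℝ => C / |y|) (cocompact ℝ) (𝓝 0) :=
      tendsto_const_nhds.div_atTop (tendsto_norm_cocompact_atTop (E := ℝ))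
    have h2 := hquot.norm.add h1
    rw [norm_zero, add_zero] at h2
    refine squeeze_zero_norm' ?_ h2
    filter_upwards [(isCompact_singleton (x := (0 : ℝ))).compl_mem_cocompact] with y hy
    have him : ((y : ℂ) * Complex.I).im = y := by simp
    have hy0 : ((y : ℂ) * Complex.I).im ≠ 0 := by rw [him]; exact hy
    rw [hheq _ hy0]
    refine (norm_sub_le _ _).trans ?_
    rw [hquotI]
    have := hTB _ hy0
    rw [him] at this
    gcongr
  have hh0 := eq_zero_of_subexponential_of_tendsto_zero hhd hexp hlim
  have := hBh z
  rw [hh0, mul_zero] at this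
  exact sub_eq_zero.1 this.symm

/-- The Lagrange interpolation formula: under the extra decay assumptions
`y·|F(iy)| = o(|B(iy)|)` and `∑ |x|·W(x)/|B'(x)| < ∞`, one has
`z·F(z) = ∑_{B(x)=0} (x·F(x)/B'(x))·B(z)/(z−x)` with locally uniform convergence;
at `z = x` the term `B(z)/(z−x)` is interpreted as `B'(x)`. -/
theorem stmt13 (L : Submodule ℂ (ℂ → ℂ)) (hL : IsAlgebraicDeBranges L)
    (W : ℝ → ℝ≥0∞) (hW : IsWeight W) (hsub : SubsetC0e W L)
    (F : ℂ → ℂ) (hF : F ∈ L) (B : ℂ → ℂ) (hB : B ∈ KreinClass L W)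
    (hdecay : (fun y : ℝ => (y : ℂ) * F ((y : ℂ) * Complex.I)) =o[atTop ⊔ atBot]
      (fun y : ℝ => B ((y : ℂ) * Complex.I)))
    (hsum : (∑' x : {t : ℝ // B (t : ℂ) = 0},
        ENNReal.ofReal |x.1| * W x.1 / (‖deriv B (x.1 : ℂ)‖₊ : ℝ≥0∞)) ≠ ⊤) :
    -- the summands, with `B(z)/(z−x)` read as `B'(x)` at `z = x`
    ∀ term : {t : ℝ // B (t : ℂ) = 0} → ℂ → ℂ,
      (term = fun x z =>
        ((x.1 : ℂ) * F (x.1 : ℂ) / deriv B (x.1 : ℂ)) *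
          (if z = (x.1 : ℂ) then deriv B (x.1 : ℂ) else B z / (z - (x.1 : ℂ)))) →
      (∀ z : ℂ, HasSum (fun x => term x z) (z * F z)) ∧
      (∀ K : Set ℂ, IsCompact K →
        TendstoUniformlyOn
          (fun (s : Finset {t : ℝ // B (t : ℂ) = 0}) (z : ℂ) => ∑ x ∈ s, term x z)
          (fun z => z * F z) atTop K) := by
  rintro term rfl
  obtain ⟨hBd, -, hz, hsymm, hK2, -, -⟩ := hB
  have hsimple : ∀ z, B z = 0 → deriv B z ≠ 0 := fun z h => (hz z h).2
  have hc := summable_norm_of_tsum_weight_ne_top hBd hsimple hW.2.1 (hsub F hF) hsum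
  have hterm : (fun (x : {t : ℝ // B (t : ℂ) = 0}) (z : ℂ) =>
      ((x.1 : ℂ) * F (x.1 : ℂ) / deriv B (x.1 : ℂ)) *
        (if z = (x.1 : ℂ) then deriv B (x.1 : ℂ) else B z / (z - (x.1 : ℂ)))) =
      fun x z => ((x.1 : ℂ) * F (x.1 : ℂ) / deriv B (x.1 : ℂ)) * dslope B (x.1 : ℂ) z := by
    funext x z
    congr 1
    split_ifs with h
    · rw [h, dslope_same]
    · rw [dslope_of_ne _ h, slope_def_field, x.2, sub_zero]
  have hmain := mul_eq_lagrange (hL.1 F hF) hBd (fun z h => (hz z h).1) hsimple hsymm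
    (hK2 F hF).1 (hK2 _ (hL.2.2 F hF)).1 hdecay hc
  rw [hterm]
  refine ⟨fun z => ?_, fun K hK => ?_⟩
  · rw [hmain z]
    exact (summable_lagrange hBd hc z).hasSum
  · rw [funext hmain]
    exact tendstoUniformlyOn_lagrange hBd hc hK
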